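/- arXiv:1101.6016 — 4 statements merged into one kernel-verified Lean document; each statement's English description precedes it below -/
import Mathlib

section
/- For every strategy profile s, every player j, and every channel i, if s' denotes the profile obtained from s by letting player j switch to channel i while all other players keep their strategies, then Φ(s') − Φ(s) = U_j(s') − U_j(s). In other words, Φ is an exact potential for the spectrum access game, so the game is a potential (congestion) game. -/
/-- Number of players on channel `i` under strategy profile `s`. -/
def occupancy {C N : ℕ} (s : Fin N → Fin C) (i : Fin C) : ℕ :=
  (Finset.univ.filter (fun j => s j = i)).card

/-- Utility of player `j`: availability of its channel divided by
the number of players sharing that channel. -/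
noncomputable def utility {C N : ℕ} (μ : Fin C → ℝ) (s : Fin N → Fin C) (j : Fin N) : ℝ :=
  μ (s j) / (occupancy s (s j) : ℝ)

/-- Rosenthal potential `Φ(s) = Σ_i Σ_{t=1}^{n_i(s)} μ_i / t`. -/
noncomputable def rosenthalPotential {C N : ℕ} (μ : Fin C → ℝ) (s : Fin N → Fin C) : ℝ :=
  ∑ i : Fin C, ∑ t ∈ Finset.Icc 1 (occupancy s i), μ i / (t : ℝ)

/-- Number of players other than `j` on channel `k`. -/
def othersOn {C N : ℕ} (s : Fin N → Fin C) (j : Fin N) (k : Fin C) : ℕ :=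
  ((Finset.univ.erase j).filter (fun l => s l = k)).card

lemma occupancy_eq_others {C N : ℕ} (s : Fin N → Fin C) (j : Fin N) (k : Fin C) :
    occupancy s k = othersOn s j k + if s j = k then 1 else 0 := by
  unfold occupancy othersOn
  rw [← Finset.insert_erase (Finset.mem_univ j), Finset.filter_insert]
  split_ifs with h
  · rw [Finset.card_insert_of_notMem (by simp)]
    simp
  · simp

lemma othersOn_update {C N : ℕ} (s : Fin N → Fin C) (j : Fin N) (i k : Fin C) :
    othersOn (Function.update s j i) j k = othersOn s j k := by
  unfold othersOn
  congr 1
  apply Finset.filter_congr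
  intro l hl
  rw [Function.update_of_ne (Finset.ne_of_mem_erase hl)]

lemma potential_eq_others {C N : ℕ} (μ : Fin C → ℝ) (s : Fin N → Fin C) (j : Fin N) :
    rosenthalPotential μ s =
      (∑ k : Fin C, ∑ t ∈ Finset.Icc 1 (othersOn s j k), μ k / (t : ℝ)) + utility μ s j := by
  have key : ∀ k : Fin C, ∑ t ∈ Finset.Icc 1 (occupancy s k), μ k / (t : ℝ) =
      (∑ t ∈ Finset.Icc 1 (othersOn s j k), μ k / (t : ℝ)) +
        if s j = k then μ k / (occupancy s k : ℝ) else 0 := by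
    intro k
    rw [occupancy_eq_others s j k]
    split_ifs with h
    · rw [Finset.sum_Icc_succ_top (by omega)]
    · simp
  unfold rosenthalPotential utility
  simp only [key, Finset.sum_add_distrib, Finset.sum_ite_eq, Finset.mem_univ, if_true]

/-- The Rosenthal potential is an exact potential for the spectrum access game. -/
theorem rosenthal_exact_potential {C N : ℕ} (hC : 1 ≤ C) (hN : 1 ≤ N)
    (μ : Fin C → ℝ) (hμ : ∀ i, 0 < μ i)
    (s : Fin N → Fin C) (j : Fin N) (i : Fin C) :
    rosenthalPotential μ (Function.update s j i) - rosenthalPotential μ s =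
      utility μ (Function.update s j i) j - utility μ s j := by
  rw [potential_eq_others μ s j, potential_eq_others μ (Function.update s j i) j]
  simp only [othersOn_update]
  ring
end

section
/- The spectrum access game admits a pure-strategy Nash equilibrium: there exists a strategy profile s* such that for every player j and every channel i, U_j(s*) ≥ U_j(s*[j ↦ i]), where s*[j ↦ i] is the profile obtained from s* by letting player j unilaterally switch to channel i. Equivalently, μ_{s*_j} / n_{s*_j}(s*) ≥ μ_i / (n_i(s*) + 1) for every j and every channel i ≠ s*_j. -/
/-- Number of players other than `j` on channel `i`. -/
def othersOcc {C N : ℕ} (s : Fin N → Fin C) (j : Fin N) (i : Fin C) : ℕ :=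
  ((Finset.univ.erase j).filter (fun l => s l = i)).card

/-- Rosenthal potential. -/
noncomputable def rosenthal {C N : ℕ} (μ : Fin C → ℝ) (s : Fin N → Fin C) : ℝ :=
  ∑ c, ∑ k ∈ Finset.range (occupancy s c), μ c / ((k + 1 : ℕ) : ℝ)

lemma occupancy_update {C N : ℕ} (s : Fin N → Fin C) (j : Fin N) (i c : Fin C) :
    occupancy (Function.update s j i) c = othersOcc s j c + if c = i then 1 else 0 := by
  unfold occupancy othersOcc
  rw [← Finset.insert_erase (Finset.mem_univ j), Finset.filter_insert]
  have h : ((Finset.univ.erase j).filter (fun l => Function.update s j i l = c))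
      = ((Finset.univ.erase j).filter (fun l => s l = c)) := by
    apply Finset.filter_congr
    intro l hl
    rw [Function.update_of_ne (Finset.ne_of_mem_erase hl)]
  rw [h]
  by_cases hc : c = i
  · subst hc
    simp
  · have hc' : ¬ i = c := fun h => hc h.symm
    simp [hc, hc']

lemma rosenthal_update {C N : ℕ} (μ : Fin C → ℝ) (s : Fin N → Fin C) (j : Fin N) (i : Fin C) :
    rosenthal μ (Function.update s j i) =
      (∑ c, ∑ k ∈ Finset.range (othersOcc s j c), μ c / ((k + 1 : ℕ) : ℝ))
        + utility μ (Function.update s j i) j := by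
  have h : ∀ c, ∑ k ∈ Finset.range (occupancy (Function.update s j i) c), μ c / ((k + 1 : ℕ) : ℝ)
      = (∑ k ∈ Finset.range (othersOcc s j c), μ c / ((k + 1 : ℕ) : ℝ))
        + if c = i then μ c / ((othersOcc s j c + 1 : ℕ) : ℝ) else 0 := by
    intro c
    rw [occupancy_update]
    split_ifs
    · rw [Finset.sum_range_succ]
    · simp
  unfold rosenthal utility
  rw [Finset.sum_congr rfl (fun c _ => h c), Finset.sum_add_distrib, Function.update_self, occupancy_update]
  simp

/-- The spectrum access game admits a pure-strategy Nash equilibrium: there is a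
profile `s*` such that no player can improve its utility by unilaterally switching
to another channel. -/
theorem exists_pure_nash_equilibrium {C N : ℕ} (hC : 1 ≤ C) (hN : 1 ≤ N)
    (μ : Fin C → ℝ) (hμ : ∀ i, 0 < μ i) :
    ∃ s : Fin N → Fin C, ∀ (j : Fin N) (i : Fin C),
      utility μ s j ≥ utility μ (Function.update s j i) j := by
  haveI : Nonempty (Fin C) := ⟨⟨0, hC⟩⟩
  obtain ⟨s, hs⟩ := Finite.exists_max (rosenthal (N := N) μ)
  refine ⟨s, fun j i => ?_⟩
  have h1 := rosenthal_update μ s j i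
  have h2 := rosenthal_update μ s j (s j)
  rw [Function.update_eq_self] at h2
  have h3 := hs (Function.update s j i)
  linarith
end

section
/- Let μ_1,…,μ_C > 0, N > 0, σ > 0, c = (Σ_{l=1}^C μ_l)/N with 0 < σc < 1, and let f : ℝ^C → ℝ^C be given by f(x)_i = x_i + σ(μ_i/N − x_i c). Then: (a) f maps the simplex {x : x_i ≥ 0, Σ_i x_i = 1} into itself; (b) for every starting point x ∈ ℝ^C and every n ∈ ℕ, max_i |f^{(n)}(x)_i − x_i*| = (1 − σc)^n · max_i |x_i − x_i*|, where x_i* = μ_i / Σ_{l=1}^C μ_l; hence the iterates f^{(n)}(x) converge to x* as n → ∞, the unique fixed point of f, which is the Nash equilibrium of the spectrum access game. -/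
/-- Sup norm of a vector indexed by `Fin C` (with `C > 0`). -/
noncomputable def supNorm {C : ℕ} (hC : 0 < C) (u : Fin C → ℝ) : ℝ :=
  Finset.univ.sup' (Finset.univ_nonempty_iff.mpr ⟨⟨0, hC⟩⟩) fun i => |u i|

/-- The discrete replicator map `f(x)_i = x_i + σ(μ_i/N − x_i c)` maps the simplex to
itself, its iterates contract to the Nash equilibrium `x_i* = μ_i / Σ_l μ_l` at
geometric rate `1 − σc`, and `x*` is its unique fixed point. -/
theorem pisap_replicator_iterates_converge {C : ℕ} (hC : 0 < C)
    (μ : Fin C → ℝ) (hμ : ∀ i, 0 < μ i) (N σ : ℝ) (hN : 0 < N) (hσ : 0 < σ)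
    (c : ℝ) (hc : c = (∑ l, μ l) / N) (h0 : 0 < σ * c) (h1 : σ * c < 1)
    (f : (Fin C → ℝ) → (Fin C → ℝ))
    (hf : ∀ x i, f x i = x i + σ * (μ i / N - x i * c))
    (xstar : Fin C → ℝ) (hxstar : ∀ i, xstar i = μ i / ∑ l, μ l) :
    (∀ x : Fin C → ℝ, (∀ i, 0 ≤ x i) → ∑ i, x i = 1 →
      (∀ i, 0 ≤ f x i) ∧ ∑ i, f x i = 1) ∧
    (∀ (x : Fin C → ℝ) (n : ℕ),
      supNorm hC (fun i => (f^[n] x) i - xstar i)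
        = (1 - σ * c) ^ n * supNorm hC (fun i => x i - xstar i)) ∧
    (∀ x : Fin C → ℝ, Filter.Tendsto (fun n => f^[n] x) Filter.atTop (nhds xstar)) ∧
    f xstar = xstar ∧
    (∀ z : Fin C → ℝ, f z = z → z = xstar) := by
  have hS : 0 < ∑ l, μ l :=
    Finset.sum_pos (fun i _ => hμ i) (Finset.univ_nonempty_iff.mpr ⟨⟨0, hC⟩⟩)
  have hcx : ∀ i, μ i / N = c * xstar i := by
    intro i
    rw [hc, hxstar]
    field_simp
  have hstep : ∀ x i, f x i - xstar i = (1 - σ * c) * (x i - xstar i) := by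
    intro x i
    rw [hf, hcx]
    ring
  have hiter : ∀ (n : ℕ) (x : Fin C → ℝ) (i : Fin C),
      (f^[n] x) i - xstar i = (1 - σ * c) ^ n * (x i - xstar i) := by
    intro n
    induction n with
    | zero => intro x i; simp
    | succ k ih =>
      intro x i
      rw [Function.iterate_succ_apply, ih, hstep]
      ring
  have hr : 0 < 1 - σ * c := by linarith
  refine ⟨?_, ?_, ?_, ?_, ?_⟩
  · intro x hx hsum
    constructor
    · intro i
      have h2 : 0 ≤ (1 - σ * c) * x i := mul_nonneg hr.le (hx i)
      have h3 : 0 ≤ σ * (μ i / N) := mul_nonneg hσ.le (div_nonneg (hμ i).le hN.le)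
      rw [hf]
      nlinarith
    · simp only [hf]
      rw [Finset.sum_add_distrib, ← Finset.mul_sum, Finset.sum_sub_distrib,
        ← Finset.sum_div, ← Finset.sum_mul, hsum, ← hc]
      ring
  · intro x n
    unfold supNorm
    rw [Finset.mul₀_sup' (pow_pos hr n).le]
    congr 1
    funext i
    beta_reduce
    rw [hiter, abs_mul, abs_of_pos (pow_pos hr n)]
  · intro x
    rw [tendsto_pi_nhds]
    intro i
    have h2 : ∀ n, (f^[n] x) i = (1 - σ * c) ^ n * (x i - xstar i) + xstar i := by
      intro n
      rw [← hiter]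
      ring
    simp only [h2]
    have h3 := tendsto_pow_atTop_nhds_zero_of_lt_one hr.le (by linarith : 1 - σ * c < 1)
    simpa using (h3.mul_const (x i - xstar i)).add_const (xstar i)
  · funext i
    have := hstep xstar i
    rw [sub_self, mul_zero] at this
    linarith
  · intro z hz
    funext i
    have h2 := hstep z i
    rw [hz] at h2
    have h3 : σ * c * (z i - xstar i) = 0 := by linarith
    rcases mul_eq_zero.mp h3 with h | h <;> linarith
end

section
/- Let μ_1,…,μ_C > 0 and N > 0, set c = (Σ_{l=1}^C μ_l)/N, and assume 0 < c < 1. Define g : ℝ^C → ℝ^C by g(x)_i = x_i + (2 − c)(μ_i/N − c·x_i). Then 0 < (2−c)c < 1, and for all x, y ∈ ℝ^C, max_i |g(x)_i − g(y)_i| = (1 − (2−c)c) · max_i |x_i − y_i|, so g is a contraction in the sup norm; its unique fixed point is x* with x_i* = μ_i / Σ_{l=1}^C μ_l, and for every starting point x the iterates satisfy max_i |g^{(n)}(x)_i − x_i*| = (1 − (2−c)c)^n · max_i |x_i − x_i*| → 0, so the system converges to the Nash equilibrium of the spectrum access game. -/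
theorem supNorm_smul_aux {C : ℕ} (hC : 0 < C) (k : ℝ) (hk : 0 ≤ k) (u v : Fin C → ℝ)
    (h : ∀ i, u i = k * v i) : supNorm hC u = k * supNorm hC v := by
  unfold supNorm
  apply le_antisymm
  · apply Finset.sup'_le
    intro i hi
    rw [h i, abs_mul, abs_of_nonneg hk]
    exact mul_le_mul_of_nonneg_left (Finset.le_sup' (fun i => |v i|) hi) hk
  · obtain ⟨i, hi, he⟩ := Finset.exists_mem_eq_sup'
      (Finset.univ_nonempty_iff.mpr ⟨⟨0, hC⟩⟩) (fun i : Fin C => |v i|)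
    rw [he]
    have h2 : k * |v i| = |u i| := by rw [h i, abs_mul, abs_of_nonneg hk]
    rw [h2]
    exact Finset.le_sup' (fun i => |u i|) hi

/-- The discrete aggregate monotone map `g(x)_i = x_i + (2 − c)(μ_i/N − c x_i)` with
`c = (Σ_l μ_l)/N ∈ (0,1)` is a sup-norm contraction with constant `1 − (2−c)c`, its
unique fixed point is the Nash equilibrium `x_i* = μ_i / Σ_l μ_l`, and its iterates
converge to it at geometric rate. -/
theorem disap_aggregate_monotone_contraction {C : ℕ} (hC : 0 < C)
    (μ : Fin C → ℝ) (hμ : ∀ i, 0 < μ i) (N : ℝ) (hN : 0 < N)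
    (c : ℝ) (hc : c = (∑ l, μ l) / N) (h0 : 0 < c) (h1 : c < 1)
    (g : (Fin C → ℝ) → (Fin C → ℝ))
    (hg : ∀ x i, g x i = x i + (2 - c) * (μ i / N - c * x i))
    (xstar : Fin C → ℝ) (hxstar : ∀ i, xstar i = μ i / ∑ l, μ l) :
    (0 < (2 - c) * c ∧ (2 - c) * c < 1) ∧
    (∀ x y : Fin C → ℝ,
      supNorm hC (fun i => g x i - g y i)
        = (1 - (2 - c) * c) * supNorm hC (fun i => x i - y i)) ∧
    g xstar = xstar ∧
    (∀ z : Fin C → ℝ, g z = z → z = xstar) ∧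
    (∀ (x : Fin C → ℝ) (n : ℕ),
      supNorm hC (fun i => (g^[n] x) i - xstar i)
        = (1 - (2 - c) * c) ^ n * supNorm hC (fun i => x i - xstar i)) ∧
    (∀ x : Fin C → ℝ, Filter.Tendsto (fun n => g^[n] x) Filter.atTop (nhds xstar)) := by
  have hk0 : 0 < (2 - c) * c := by nlinarith
  have hk1 : (2 - c) * c < 1 := by nlinarith [mul_pos (sub_pos.2 h1) (sub_pos.2 h1)]
  have hS : (∑ l, μ l) = c * N := by rw [hc]; field_simp
  have hm : ∀ i, μ i / N = c * xstar i := by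
    intro i
    rw [hxstar, hS]
    field_simp
  have hfix : g xstar = xstar := by
    funext i
    rw [hg, hm]
    ring
  have hd : ∀ x y i, g x i - g y i = (1 - (2 - c) * c) * (x i - y i) := by
    intro x y i
    rw [hg, hg]
    ring
  have hit : ∀ (x : Fin C → ℝ) (n : ℕ) (i : Fin C),
      (g^[n] x) i - xstar i = (1 - (2 - c) * c) ^ n * (x i - xstar i) := by
    intro x n i
    induction n with
    | zero => simp
    | succ n ih =>
      have h := hd (g^[n] x) xstar i
      rw [hfix, ih] at h
      rw [Function.iterate_succ_apply', h]
      ring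
  have hk : 0 ≤ 1 - (2 - c) * c := by linarith
  refine ⟨⟨hk0, hk1⟩, fun x y => supNorm_smul_aux hC _ hk _ _ (hd x y), hfix, ?_,
    fun x n => supNorm_smul_aux hC _ (pow_nonneg hk n) _ _ (hit x n), ?_⟩
  · intro z hz
    funext i
    have h := hd z xstar i
    rw [hz, hfix] at h
    have h3 : (2 - c) * c * (z i - xstar i) = 0 := by linarith
    rcases mul_eq_zero.1 h3 with h4 | h4
    · exact absurd h4 hk0.ne'
    · linarith
  · intro x
    rw [tendsto_pi_nhds]
    intro i
    have he : (fun n => (g^[n] x) i)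
        = fun n => (1 - (2 - c) * c) ^ n * (x i - xstar i) + xstar i := by
      funext n
      linarith [hit x n i]
    rw [he]
    have ht := ((tendsto_pow_atTop_nhds_zero_of_lt_one hk (by linarith)).mul_const
      (x i - xstar i)).add_const (xstar i)
    simpa using ht
end
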